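/- arXiv:1610.00176 — 2 statements merged into one kernel-verified Lean document; each statement's English description precedes it below -/
import Mathlib

section
/- Suppose s = C(α+1, 2) and X has the generic Hilbert function, i.e. dim_k R_i − dim_k (I_X)_i = min{C(i+2,2), s} for all i ≥ 0, where α := α(I_X). Then for every t ≥ 2α one has (I_X^{(2)})_t = (I_X^2)_t; consequently, every minimal generator of I_X^{(2)} not lying in I_X^2 has degree strictly less than 2α. -/
open MvPolynomial

/-- The homogeneous ideal of the point of `ℙ²` represented by `v ∈ k³`:
the ideal generated by all linear forms vanishing at `v`. -/
noncomputable def pointIdeal {k : Type*} [Field k] (v : Fin 3 → k) :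
    Ideal (MvPolynomial (Fin 3) k) :=
  Ideal.span {f | f.IsHomogeneous 1 ∧ MvPolynomial.eval v f = 0}

/-- The ideal `I_X = ⋂ᵢ I_{vᵢ}` of the set of points represented by `v`. -/
noncomputable def pointsIdeal {k : Type*} [Field k] {s : ℕ} (v : Fin s → (Fin 3 → k)) :
    Ideal (MvPolynomial (Fin 3) k) :=
  ⨅ i, pointIdeal (v i)

/-- The `m`-th symbolic power `I_X^{(m)} = ⋂ᵢ I_{vᵢ}^m`. -/
noncomputable def pointsSymb {k : Type*} [Field k] {s : ℕ} (v : Fin s → (Fin 3 → k)) (m : ℕ) :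
    Ideal (MvPolynomial (Fin 3) k) :=
  ⨅ i, (pointIdeal (v i)) ^ m

/-- The degree-`t` graded component of an ideal of `k[x₀,x₁,x₂]`, as a `k`-subspace. -/
noncomputable def gradedPiece {k : Type*} [Field k]
    (I : Ideal (MvPolynomial (Fin 3) k)) (t : ℕ) :
    Submodule k (MvPolynomial (Fin 3) k) :=
  Submodule.restrictScalars k I ⊓ MvPolynomial.homogeneousSubmodule (Fin 3) k t

section LinearForms

variable {k σ : Type*} [Field k]

theorem MvPolynomial.IsHomogeneous.exists_eq_C {f : MvPolynomial σ k} (hf : f.IsHomogeneous 0) :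
    ∃ c, f = C c :=
  ⟨_, totalDegree_eq_zero_iff_eq_C.1 ((totalDegree_zero_iff_isHomogeneous σ).2 hf)⟩

theorem MvPolynomial.IsHomogeneous.exists_eq_sum_X_mul [Fintype σ] {n : ℕ} {B : MvPolynomial σ k}
    (hB : B.IsHomogeneous (n + 1)) :
    ∃ E : σ → MvPolynomial σ k, (∀ b, (E b).IsHomogeneous n) ∧ B = ∑ b, X b * E b := by
  rw [← mem_homogeneousSubmodule, ← homogeneousSubmodule_one_pow, pow_succ,
    homogeneousSubmodule_one_pow] at hB
  induction hB using Submodule.mul_induction_on' with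
  | mem_mul_mem f hf g hg =>
    refine ⟨fun b => f * pderiv b g, fun b => ?_, ?_⟩
    · exact ((mem_homogeneousSubmodule _ _).1 hf).mul (((mem_homogeneousSubmodule _ _).1 hg).pderiv)
    · have h := ((mem_homogeneousSubmodule _ _).1 hg).sum_X_mul_pderiv
      rw [one_smul] at h
      conv_lhs => rw [← h, Finset.mul_sum]
      exact Finset.sum_congr rfl fun b _ => by ring
  | add f _ g _ hf hg =>
    obtain ⟨E, hE, rfl⟩ := hf
    obtain ⟨E', hE', rfl⟩ := hg
    exact ⟨E + E', fun b => (hE b).add (hE' b), by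
      simp [mul_add, Finset.sum_add_distrib]⟩

/-- A form vanishing at `v` is a combination of the linear forms `X b - v b * l`, which generate
the ideal of `[v]` whenever `l` is a linear form with `l(v) = 1`. -/
theorem MvPolynomial.IsHomogeneous.exists_eq_sum_of_eval_eq_zero [Fintype σ] {v : σ → k}
    {l : MvPolynomial σ k} {n : ℕ} {B : MvPolynomial σ k} (hB : B.IsHomogeneous (n + 1))
    (hl : l.IsHomogeneous 1) (hv : eval v B = 0) :
    ∃ D : σ → MvPolynomial σ k, (∀ b, (D b).IsHomogeneous n) ∧
      B = ∑ b, (X b - C (v b) * l) * D b := by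
  induction n generalizing B with
  | zero =>
    obtain ⟨E, hE, rfl⟩ := hB.exists_eq_sum_X_mul
    refine ⟨E, hE, ?_⟩
    choose c hc using fun b => (hE b).exists_eq_C
    have : ∑ b, C (v b) * l * E b = 0 := by
      have h0 : ∑ b, v b * c b = 0 := by simpa [hc] using hv
      calc ∑ b, C (v b) * l * E b = l * C (∑ b, v b * c b) := by
            rw [map_sum, Finset.mul_sum]
            exact Finset.sum_congr rfl fun b _ => by rw [hc, map_mul]; ring
        _ = 0 := by rw [h0]; simp
    simp [sub_mul, Finset.sum_sub_distrib, this]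
  | succ n ih =>
    obtain ⟨E, hE, rfl⟩ := hB.exists_eq_sum_X_mul
    obtain ⟨D, hD, h⟩ := ih (B := ∑ b, C (v b) * E b)
      (.sum _ _ _ fun b _ => (hE b).C_mul _) (by simpa using hv)
    refine ⟨fun b => E b + l * D b, fun b => (hE b).add ?_, ?_⟩
    · rw [add_comm]
      exact hl.mul (hD b)
    · have : l * ∑ b, C (v b) * E b = ∑ b, (X b - C (v b) * l) * (l * D b) := by
        rw [h, Finset.mul_sum]
        exact Finset.sum_congr rfl fun b _ => by ring
      simp only [mul_add, Finset.sum_add_distrib, ← this, Finset.mul_sum]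
      rw [← Finset.sum_add_distrib]
      exact Finset.sum_congr rfl fun b _ => by ring

theorem MvPolynomial.isHomogeneous_X_sub_C_mul {l : MvPolynomial σ k}
    (hl : l.IsHomogeneous 1) (b : σ) (c : k) : (X b - C c * l).IsHomogeneous 1 :=
  (isHomogeneous_X _ _).sub (hl.C_mul _)

/-- A linear functional on `σ → k` as a linear form. -/
theorem MvPolynomial.exists_isHomogeneous_one_eval_eq [Fintype σ] [DecidableEq σ]
    (f : (σ → k) →ₗ[k] k) :
    ∃ l : MvPolynomial σ k, l.IsHomogeneous 1 ∧ ∀ v, eval v l = f v := by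
  refine ⟨∑ b, C (f (Pi.single b 1)) * X b,
    .sum _ _ _ fun b _ => isHomogeneous_C_mul_X _ _, fun v => ?_⟩
  rw [f.pi_apply_eq_sum_univ]
  simp only [map_sum, map_mul, eval_C, eval_X, smul_eq_mul]
  exact Finset.sum_congr rfl fun b _ => by
    rw [mul_comm]
    congr 2
    ext j
    simp [Pi.single_apply, eq_comm]

theorem MvPolynomial.exists_isHomogeneous_one_eval_eq_one [Fintype σ] [DecidableEq σ]
    {v : σ → k} (hv : v ≠ 0) : ∃ l : MvPolynomial σ k, l.IsHomogeneous 1 ∧ eval v l = 1 := by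
  obtain ⟨f, hf, -⟩ := Submodule.exists_le_ker_of_notMem (p := (⊥ : Submodule k (σ → k)))
    (v := v) (by simpa using hv)
  obtain ⟨l, hl, h⟩ := exists_isHomogeneous_one_eval_eq ((f v)⁻¹ • f)
  exact ⟨l, hl, by simp [h, hf]⟩

theorem MvPolynomial.exists_isHomogeneous_one_eval_eq_one_eval_eq_zero [Fintype σ]
    [DecidableEq σ] {v w : σ → k} (h : LinearIndependent k ![v, w]) :
    ∃ l : MvPolynomial σ k, l.IsHomogeneous 1 ∧ eval v l = 1 ∧ eval w l = 0 := by
  obtain ⟨f, hf, hw⟩ := Submodule.exists_le_ker_of_notMem (p := k ∙ w) (v := v) (by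
    rw [Submodule.mem_span_singleton]
    rintro ⟨a, ha⟩
    have := LinearIndependent.pair_iff.1 h 1 (-a) (by simp [ha])
    simp at this)
  have hw : f w = 0 := hw (Submodule.mem_span_singleton_self w)
  obtain ⟨l, hl, h⟩ := exists_isHomogeneous_one_eval_eq ((f v)⁻¹ • f)
  exact ⟨l, hl, by simp [h, hf], by simp [h, hw]⟩

theorem MvPolynomial.finrank_homogeneousSubmodule_fin_three (n : ℕ) :
    Module.finrank k (homogeneousSubmodule (Fin 3) k n) = Nat.choose (n + 2) 2 := by
  rw [homogeneousSubmodule_eq_finsupp_supported,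
    (AddMonoidAlgebra.supportedEquivFinsupp _).finrank_eq]
  have : {d : Fin 3 →₀ ℕ | d.degree = n} =
      ((Finset.univ.finsuppAntidiag n : Finset (Fin 3 →₀ ℕ)) : Set (Fin 3 →₀ ℕ)) := by
    ext d
    simp [Finset.mem_finsuppAntidiag, Finsupp.degree_eq_sum]
  rw [this, Module.finrank_finsupp_self, ← Nat.card_eq_fintype_card, Nat.card_coe_set_eq,
    Set.ncard_coe_finset, Finset.card_finsuppAntidiag_nat_eq_choose]
  simp only [Finset.card_univ, Fintype.card_fin]
  rw [show 3 + n - 1 = n + 2 by omega, Nat.choose_symm_add]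

end LinearForms

section Points

variable {k : Type*} [Field k]

theorem eval_eq_zero_of_mem_pointIdeal {v : Fin 3 → k} {f : MvPolynomial (Fin 3) k}
    (hf : f ∈ pointIdeal v) : eval v f = 0 := by
  have : pointIdeal v ≤ RingHom.ker (eval v) :=
    Ideal.span_le.2 fun g hg => hg.2
  exact this hf

theorem mem_pointIdeal_of_eval_eq_zero {v : Fin 3 → k} (hv : v ≠ 0) {d : ℕ}
    {f : MvPolynomial (Fin 3) k} (hf : f.IsHomogeneous d) (h0 : eval v f = 0) :
    f ∈ pointIdeal v := by
  cases d with
  | zero =>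
    obtain ⟨c, rfl⟩ := hf.exists_eq_C
    rw [eval_C] at h0
    simp [h0]
  | succ d =>
    obtain ⟨l, hl, hlv⟩ := exists_isHomogeneous_one_eval_eq_one hv
    obtain ⟨D, -, rfl⟩ := hf.exists_eq_sum_of_eval_eq_zero hl h0
    exact Ideal.sum_mem _ fun b _ => Ideal.mul_mem_right _ _
      (Ideal.subset_span ⟨isHomogeneous_X_sub_C_mul hl b _, by simp [hlv]⟩)

theorem eval_pderiv_eq_zero_of_mem_pointIdeal_sq {v : Fin 3 → k} {f : MvPolynomial (Fin 3) k}
    (hf : f ∈ pointIdeal v ^ 2) (b : Fin 3) : eval v (pderiv b f) = 0 := by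
  rw [pow_two] at hf
  induction hf using Submodule.mul_induction_on' with
  | mem_mul_mem f hf g hg =>
    simp [Derivation.leibniz, eval_eq_zero_of_mem_pointIdeal hf, eval_eq_zero_of_mem_pointIdeal hg]
  | add f _ g _ hf hg => simp [hf, hg]

theorem eq_zero_of_mul_mem_pointIdeal_sq {v : Fin 3 → k} {l g : MvPolynomial (Fin 3) k}
    (hl : l.IsHomogeneous 1) (hg : eval v g ≠ 0) (h : l * g ∈ pointIdeal v ^ 2) : l = 0 := by
  have hlv : eval v l = 0 := by
    have := eval_eq_zero_of_mem_pointIdeal (Ideal.pow_le_self two_ne_zero h)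
    simpa [hg] using this
  have hd : ∀ b, pderiv b l = 0 := fun b => by
    have h1 := eval_pderiv_eq_zero_of_mem_pointIdeal_sq h b
    obtain ⟨c, hc⟩ := (hl.pderiv (i := b)).exists_eq_C
    rw [Derivation.leibniz, hc] at h1
    simp only [smul_eq_mul, map_add, map_mul, hlv, zero_mul, eval_C, zero_add, mul_eq_zero] at h1
    rw [hc, h1.resolve_left hg, C_0]
  have := hl.sum_X_mul_pderiv
  simpa [hd, eq_comm] using this

theorem mem_pointsIdeal_of_eval_eq_zero {s : ℕ} {v : Fin s → Fin 3 → k} (hv : ∀ i, v i ≠ 0)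
    {d : ℕ} {f : MvPolynomial (Fin 3) k} (hf : f.IsHomogeneous d)
    (h0 : ∀ i, eval (v i) f = 0) : f ∈ pointsIdeal v :=
  Ideal.mem_iInf.2 fun i => mem_pointIdeal_of_eval_eq_zero (hv i) hf (h0 i)

theorem eval_eq_zero_of_mem_pointsIdeal {s : ℕ} {v : Fin s → Fin 3 → k}
    {f : MvPolynomial (Fin 3) k} (hf : f ∈ pointsIdeal v) (i : Fin s) : eval (v i) f = 0 :=
  eval_eq_zero_of_mem_pointIdeal (Ideal.mem_iInf.1 hf i)

theorem pointsIdeal_sq_le_pointsSymb {s : ℕ} (v : Fin s → Fin 3 → k) :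
    pointsIdeal v ^ 2 ≤ pointsSymb v 2 :=
  le_iInf fun i => Ideal.pow_right_mono (iInf_le _ i) 2

end Points

/-- Forms `p i` of degree `n` separating the points `v i`, such that evaluation at the points
determines every form of degree `n`. -/
structure IsSeparatorBasis {k : Type*} [Field k] {s : ℕ} (v : Fin s → Fin 3 → k) (n : ℕ)
    (p : Fin s → MvPolynomial (Fin 3) k) : Prop where
  ne_zero : ∀ i, v i ≠ 0
  linearIndependent : ∀ i j, i ≠ j → LinearIndependent k ![v i, v j]
  isHomogeneous : ∀ i, (p i).IsHomogeneous n
  eval_self : ∀ i, eval (v i) (p i) = 1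
  eval_of_ne : ∀ i j, i ≠ j → eval (v i) (p j) = 0
  eq_sum : ∀ f : MvPolynomial (Fin 3) k, f.IsHomogeneous n → f = ∑ j, C (eval (v j) f) * p j

/-- The sum of `I_X ^ 2` and of the space of all `∑ j, w j * (l j ^ m * p j ^ 2)` with linear
forms `w j`. -/
noncomputable def squareAddSpan {k : Type*} [Field k] {s : ℕ} (v : Fin s → Fin 3 → k)
    (p l : Fin s → MvPolynomial (Fin 3) k) (m : ℕ) : Submodule k (MvPolynomial (Fin 3) k) :=
  (pointsIdeal v ^ 2).restrictScalars k ⊔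
    LinearMap.range (∑ j, LinearMap.mulRight k (l j ^ m * p j ^ 2) ∘ₗ
      (homogeneousSubmodule (Fin 3) k 1).subtype ∘ₗ LinearMap.proj j :
      (Fin s → homogeneousSubmodule (Fin 3) k 1) →ₗ[k] MvPolynomial (Fin 3) k)

section SquareAddSpan

variable {k : Type*} [Field k] {s : ℕ} {v : Fin s → Fin 3 → k}
  {p l : Fin s → MvPolynomial (Fin 3) k} {m n : ℕ}

theorem mem_squareAddSpan_of_mem {f : MvPolynomial (Fin 3) k} (hf : f ∈ pointsIdeal v ^ 2) :
    f ∈ squareAddSpan v p l m :=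
  Submodule.mem_sup_left hf

theorem mul_mem_pointsIdeal_sq {f g : MvPolynomial (Fin 3) k}
    (hf : f ∈ pointsIdeal v) (hg : g ∈ pointsIdeal v) : f * g ∈ pointsIdeal v ^ 2 := by
  rw [pow_two]
  exact Ideal.mul_mem_mul hf hg

theorem mul_mem_squareAddSpan {w : MvPolynomial (Fin 3) k} (hw : w.IsHomogeneous 1) (j : Fin s) :
    w * (l j ^ m * p j ^ 2) ∈ squareAddSpan v p l m := by
  refine Submodule.mem_sup_right ⟨Pi.single j ⟨w, hw⟩, ?_⟩
  rw [LinearMap.sum_apply, Finset.sum_eq_single j]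
  · simp [mul_assoc]
  · intro i _ hi
    simp [Pi.single_eq_of_ne hi]
  · simp

theorem exists_eq_add_sum_of_mem_squareAddSpan {f : MvPolynomial (Fin 3) k}
    (hf : f ∈ squareAddSpan v p l m) :
    ∃ g ∈ pointsIdeal v ^ 2, ∃ w : Fin s → MvPolynomial (Fin 3) k,
      (∀ j, (w j).IsHomogeneous 1) ∧ f = g + ∑ j, w j * (l j ^ m * p j ^ 2) := by
  obtain ⟨g, hg, _, ⟨w, rfl⟩, rfl⟩ := Submodule.mem_sup.1 hf
  exact ⟨g, hg, fun j => w j, fun j => (w j).2, by simp [LinearMap.sum_apply, mul_assoc]⟩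

namespace IsSeparatorBasis

theorem mul_mem_pointsIdeal (h : IsSeparatorBasis v n p)
    {d : ℕ} {A : MvPolynomial (Fin 3) k} (hA : A.IsHomogeneous d)
    {j : Fin s} (h0 : eval (v j) A = 0) : A * p j ∈ pointsIdeal v := by
  refine mem_pointsIdeal_of_eval_eq_zero h.ne_zero (hA.mul (h.isHomogeneous j)) fun i => ?_
  rcases eq_or_ne i j with rfl | hij
  · simp [h0]
  · simp [h.eval_of_ne i j hij]

theorem mul_mul_mul_mem_pointsIdeal_sq (h : IsSeparatorBasis v n p)
    {i j : Fin s} (hij : i ≠ j)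
    {u B : MvPolynomial (Fin 3) k} (hu : u.IsHomogeneous 1) (hi : eval (v i) u = 0)
    (hj : eval (v j) u = 0) (hB : B.IsHomogeneous (m + 1)) :
    u * B * p i * p j ∈ pointsIdeal v ^ 2 := by
  obtain ⟨x, hx, hxi, hxj⟩ :=
    exists_isHomogeneous_one_eval_eq_one_eval_eq_zero (h.linearIndependent i j hij)
  have hx' : (x ^ (m + 1)).IsHomogeneous (m + 1) := by simpa using hx.pow (m + 1)
  have h1 := mul_mem_pointsIdeal_sq (h.mul_mem_pointsIdeal hu hj)
    (h.mul_mem_pointsIdeal (j := i) (hB.sub (hx'.C_mul (eval (v i) B))) (by simp [hxi]))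
  have h2 := mul_mem_pointsIdeal_sq (h.mul_mem_pointsIdeal hu hi)
    (h.mul_mem_pointsIdeal (j := j) (hx'.C_mul (eval (v i) B)) (by simp [hxj]))
  convert Ideal.add_mem _ h1 h2 using 1
  ring

theorem mul_mul_self_mem_squareAddSpan (h : IsSeparatorBasis v n p)
    (hl : ∀ j, (l j).IsHomogeneous 1) (hlv : ∀ j, eval (v j) (l j) = 1)
    (j : Fin s) {B : MvPolynomial (Fin 3) k}
    (hB : B.IsHomogeneous (m + 1)) : B * p j * p j ∈ squareAddSpan v p l m := by
  have hpow : ∀ a, (l j ^ a).IsHomogeneous a := fun a => by simpa using (hl j).pow a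
  have hu := fun b => isHomogeneous_X_sub_C_mul (hl j) b (v j b)
  obtain ⟨D, hD, hBD⟩ :=
    (hB.sub ((hpow (m + 1)).C_mul (eval (v j) B))).exists_eq_sum_of_eval_eq_zero
    (v := v j) (hl j) (by simp [hlv])
  have h1 : ∑ b, (X b - C (v j b) * l j) * p j * ((D b - C (eval (v j) (D b)) * l j ^ m) * p j) ∈
      pointsIdeal v ^ 2 :=
    Ideal.sum_mem _ fun b _ => mul_mem_pointsIdeal_sq
      (h.mul_mem_pointsIdeal (hu b) (by simp [hlv]))
      (h.mul_mem_pointsIdeal ((hD b).sub ((hpow m).C_mul _)) (by simp [hlv]))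
  have h2 := mul_mem_squareAddSpan (v := v) (p := p) (l := l) (m := m)
    (w := C (eval (v j) B) * l j + ∑ b, C (eval (v j) (D b)) * (X b - C (v j b) * l j))
    (((hl j).C_mul _).add (.sum _ _ _ fun b _ => (hu b).C_mul _)) j
  convert Submodule.add_mem _ (mem_squareAddSpan_of_mem h1) h2 using 1
  conv_lhs => rw [sub_eq_iff_eq_add.1 hBD]
  simp only [add_mul, Finset.sum_mul]
  rw [add_left_comm, ← Finset.sum_add_distrib, add_comm]
  congr 1
  · ring
  · exact Finset.sum_congr rfl fun b _ => by ring

theorem pow_mul_mul_mem_squareAddSpan (h : IsSeparatorBasis v n p)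
    (hl : ∀ j, (l j).IsHomogeneous 1) (hlv : ∀ j, eval (v j) (l j) = 1)
    {i j : Fin s} (hij : i ≠ j) {x : MvPolynomial (Fin 3) k}
    (hx : x.IsHomogeneous 1) (hxi : eval (v i) x = 1) (hxj : eval (v j) x = 0) :
    x ^ (m + 2) * p i * p j ∈ squareAddSpan v p l (m + 1) := by
  have hpow : (x ^ (m + 1)).IsHomogeneous (m + 1) := by simpa using hx.pow (m + 1)
  have hu := fun b => isHomogeneous_X_sub_C_mul hx b (v i b)
  have hpj := h.isHomogeneous j
  obtain _ | n := n
  · obtain ⟨c, hc⟩ := hpj.exists_eq_C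
    have h1 := h.eval_self j
    have h2 := h.eval_of_ne i j hij
    simp only [hc, eval_C] at h1 h2
    exact absurd (h2.symm.trans h1) zero_ne_one
  obtain ⟨M, hM, hpM⟩ := hpj.exists_eq_sum_of_eval_eq_zero hx (h.eval_of_ne i j hij)
  have hxM : ∀ b, x * M b = ∑ a, C (eval (v a) x * eval (v a) (M b)) * p a := fun b => by
    have := h.eq_sum (x * M b) (by rw [add_comm n]; exact hx.mul (hM b))
    simpa using this
  have key : x ^ (m + 2) * p i * p j =
      ∑ a, (∑ b, C (eval (v a) x * eval (v a) (M b)) * (X b - C (v i b) * x)) *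
        x ^ (m + 1) * p i * p a := by
    conv_lhs => rw [hpM]
    calc _ = ∑ b, (X b - C (v i b) * x) * x ^ (m + 1) * p i * (x * M b) := by
          rw [Finset.mul_sum]
          exact Finset.sum_congr rfl fun b _ => by ring
      _ = _ := by
          simp only [hxM, Finset.mul_sum, Finset.sum_mul]
          rw [Finset.sum_comm]
          exact Finset.sum_congr rfl fun a _ => Finset.sum_congr rfl fun b _ => by ring
  rw [key]
  refine Submodule.sum_mem _ fun a _ => ?_
  have hw : (∑ b, C (eval (v a) x * eval (v a) (M b)) * (X b - C (v i b) * x)).IsHomogeneous 1 :=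
    .sum _ _ _ fun b _ => (hu b).C_mul _
  rcases eq_or_ne i a with rfl | hia
  · refine h.mul_mul_self_mem_squareAddSpan hl hlv i ?_
    rw [add_comm (m + 1)]
    exact hw.mul hpow
  · refine mem_squareAddSpan_of_mem (h.mul_mul_mul_mem_pointsIdeal_sq hia hw ?_ ?_ hpow)
    · simp [hxi]
    · have : eval (v a) x * eval (v a) (p j) = 0 := by
        rcases eq_or_ne a j with rfl | haj
        · simp [hxj]
        · simp [h.eval_of_ne a j haj]
      rw [← this, hpM]
      simp only [map_sum, map_mul, eval_C, Finset.mul_sum]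
      exact Finset.sum_congr rfl fun b _ => by ring

theorem mul_mul_mem_pointsIdeal_sq (h : IsSeparatorBasis v n p)
    {i j : Fin s} (hij : i ≠ j)
    {B : MvPolynomial (Fin 3) k} (hB : B.IsHomogeneous (m + 2)) (hi : eval (v i) B = 0)
    (hj : eval (v j) B = 0) : B * p i * p j ∈ pointsIdeal v ^ 2 := by
  obtain ⟨x, hx, hxi, hxj⟩ :=
    exists_isHomogeneous_one_eval_eq_one_eval_eq_zero (h.linearIndependent i j hij)
  obtain ⟨y, hy, hyj, hyi⟩ :=
    exists_isHomogeneous_one_eval_eq_one_eval_eq_zero (h.linearIndependent j i hij.symm)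
  have hu := fun b => isHomogeneous_X_sub_C_mul hx b (v i b)
  obtain ⟨D, hD, hBD⟩ := hB.exists_eq_sum_of_eval_eq_zero hx hi
  have hjD : ∑ b, v j b * eval (v j) (D b) = 0 := by
    rw [← hj, hBD]
    simp [hxj]
  have h1 : ∑ b, (X b - C (v i b) * x - C (v j b) * y) * D b * p i * p j ∈ pointsIdeal v ^ 2 :=
    Ideal.sum_mem _ fun b _ => h.mul_mul_mul_mem_pointsIdeal_sq hij
      ((hu b).sub (hy.C_mul _)) (by simp [hxi, hyi]) (by simp [hxj, hyj]) (hD b)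
  have h2 := mul_mem_pointsIdeal_sq (h.mul_mem_pointsIdeal hy hyi)
    (h.mul_mem_pointsIdeal (j := j) (A := ∑ b, C (v j b) * D b)
      (.sum _ _ _ fun b _ => (hD b).C_mul _) (by simpa using hjD))
  convert Ideal.add_mem _ h1 h2 using 1
  rw [hBD]
  simp only [Finset.mul_sum, Finset.sum_mul]
  rw [← Finset.sum_add_distrib]
  exact Finset.sum_congr rfl fun b _ => by ring

theorem mul_mul_mem_squareAddSpan (h : IsSeparatorBasis v n p)
    (hl : ∀ j, (l j).IsHomogeneous 1) (hlv : ∀ j, eval (v j) (l j) = 1)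
    (i j : Fin s) {B : MvPolynomial (Fin 3) k}
    (hB : B.IsHomogeneous (m + 2)) : B * p i * p j ∈ squareAddSpan v p l (m + 1) := by
  rcases eq_or_ne i j with rfl | hij
  · exact h.mul_mul_self_mem_squareAddSpan hl hlv i hB
  obtain ⟨x, hx, hxi, hxj⟩ :=
    exists_isHomogeneous_one_eval_eq_one_eval_eq_zero (h.linearIndependent i j hij)
  obtain ⟨y, hy, hyj, hyi⟩ :=
    exists_isHomogeneous_one_eval_eq_one_eval_eq_zero (h.linearIndependent j i hij.symm)
  have hx' : (x ^ (m + 2)).IsHomogeneous (m + 2) := by simpa using hx.pow (m + 2)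
  have hy' : (y ^ (m + 2)).IsHomogeneous (m + 2) := by simpa using hy.pow (m + 2)
  have h1 := mem_squareAddSpan_of_mem (p := p) (l := l) (m := m + 1)
    (h.mul_mul_mem_pointsIdeal_sq hij
    ((hB.sub (hx'.C_mul (eval (v i) B))).sub (hy'.C_mul (eval (v j) B)))
    (by simp [hxi, hyi]) (by simp [hxj, hyj]))
  have h2 := h.pow_mul_mul_mem_squareAddSpan hl hlv (m := m) hij hx hxi hxj
  have h3 := h.pow_mul_mul_mem_squareAddSpan hl hlv (m := m) hij.symm hy hyj hyi
  convert Submodule.add_mem _ h1 (Submodule.add_mem _ (Submodule.smul_mem _ (eval (v i) B) h2)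
    (Submodule.smul_mem _ (eval (v j) B) h3)) using 1
  simp only [smul_eq_C_mul]
  ring

theorem exists_eq_sum_mul (h : IsSeparatorBasis v n p)
    {d : ℕ} {F : MvPolynomial (Fin 3) k} (hF : F.IsHomogeneous (n + d)) :
    ∃ A : Fin s → MvPolynomial (Fin 3) k, (∀ j, (A j).IsHomogeneous d) ∧ F = ∑ j, A j * p j := by
  induction d generalizing F with
  | zero => exact ⟨fun j => C (eval (v j) F), fun j => isHomogeneous_C _ _, h.eq_sum F hF⟩
  | succ d ih =>
    obtain ⟨E, hE, rfl⟩ := hF.exists_eq_sum_X_mul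
    choose A hA hEA using fun b => ih (hE b)
    refine ⟨fun j => ∑ b, X b * A b j, fun j => .sum _ _ _ fun b _ => ?_, ?_⟩
    · rw [add_comm]
      exact (isHomogeneous_X _ b).mul (hA b j)
    · simp only [Finset.sum_mul]
      rw [Finset.sum_comm]
      refine Finset.sum_congr rfl fun b _ => ?_
      rw [hEA b, Finset.mul_sum]
      exact Finset.sum_congr rfl fun j _ => by ring

theorem mem_squareAddSpan (h : IsSeparatorBasis v n p)
    (hl : ∀ j, (l j).IsHomogeneous 1) (hlv : ∀ j, eval (v j) (l j) = 1)
    {F : MvPolynomial (Fin 3) k}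
    (hF : F.IsHomogeneous (n + (n + (m + 2)))) : F ∈ squareAddSpan v p l (m + 1) := by
  obtain ⟨A, hA, rfl⟩ := h.exists_eq_sum_mul hF
  refine Submodule.sum_mem _ fun j _ => ?_
  obtain ⟨B, hB, hAB⟩ := h.exists_eq_sum_mul (hA j)
  rw [hAB, Finset.sum_mul]
  exact Submodule.sum_mem _ fun i _ => h.mul_mul_mem_squareAddSpan hl hlv i j (hB i)

theorem mem_pointsIdeal_sq_of_mem_pointsSymb (h : IsSeparatorBasis v n p)
    {F : MvPolynomial (Fin 3) k}
    (hF : F.IsHomogeneous (n + (n + (m + 2)))) (hFs : F ∈ pointsSymb v 2) :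
    F ∈ pointsIdeal v ^ 2 := by
  choose l hl hlv using fun j => exists_isHomogeneous_one_eval_eq_one (h.ne_zero j)
  obtain ⟨g, hg, w, hw, rfl⟩ :=
    exists_eq_add_sum_of_mem_squareAddSpan (h.mem_squareAddSpan hl hlv hF)
  have hw0 : ∀ j, w j = 0 := fun j => by
    have h1 : ∑ i, w i * (l i ^ (m + 1) * p i ^ 2) ∈ pointIdeal (v j) ^ 2 :=
      (Ideal.add_mem_iff_right _ (Ideal.mem_iInf.1 (pointsIdeal_sq_le_pointsSymb v hg) j)).1
        (Ideal.mem_iInf.1 hFs j)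
    rw [← Finset.add_sum_erase _ _ (Finset.mem_univ j), Ideal.add_mem_iff_left] at h1
    · exact eq_zero_of_mul_mem_pointIdeal_sq (hw j) (by simp [hlv, h.eval_self]) h1
    · refine Ideal.sum_mem _ fun i hi => Ideal.mul_mem_left _ _ (Ideal.mul_mem_left _ _ ?_)
      exact Ideal.pow_mem_pow (mem_pointIdeal_of_eval_eq_zero (h.ne_zero j) (h.isHomogeneous i)
        (h.eval_of_ne j i (Finset.ne_of_mem_erase hi).symm)) 2
  simpa [hw0] using hg

end IsSeparatorBasis
end SquareAddSpan

/-- If no form of degree `n` vanishes at all of the `C(n + 2, 2)` points, then evaluation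
identifies forms of degree `n` with functions on the points. -/
theorem exists_isSeparatorBasis {k : Type*} [Field k] {s n : ℕ} {v : Fin s → Fin 3 → k}
    (hv0 : ∀ i, v i ≠ 0) (hvind : ∀ i j, i ≠ j → LinearIndependent k ![v i, v j])
    (hs : s = Nat.choose (n + 2) 2) (hbot : gradedPiece (pointsIdeal v) n = ⊥) :
    ∃ p, IsSeparatorBasis v n p := by
  let e : homogeneousSubmodule (Fin 3) k n →ₗ[k] Fin s → k :=
    LinearMap.pi (fun i => (aeval (v i)).toLinearMap) ∘ₗ Submodule.subtype _
  have he : ∀ f i, e f i = eval (v i) f.1 := fun f i => by simp [e, aeval_eq_eval]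
  have hfin : Module.Finite k (homogeneousSubmodule (Fin 3) k n) :=
    Module.Finite.iff_fg.2 (homogeneousSubmodule_fg _ _ n)
  have hinj : Function.Injective e := by
    refine (injective_iff_map_eq_zero e).2 fun f hf => Subtype.ext ?_
    have : f.1 ∈ gradedPiece (pointsIdeal v) n :=
      ⟨mem_pointsIdeal_of_eval_eq_zero hv0 f.2 fun i => by rw [← he, hf]; rfl, f.2⟩
    rw [hbot] at this
    simpa using this
  have hsurj : Function.Surjective e :=
    (LinearMap.injective_iff_surjective_of_finrank_eq_finrank (by
      rw [finrank_homogeneousSubmodule_fin_three, Module.finrank_fin_fun, hs])).1 hinj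
  choose p hp using fun i : Fin s => hsurj (Pi.single i 1)
  have hpe : ∀ i j, eval (v i) (p j).1 = (Pi.single j 1 : Fin s → k) i := fun i j => by
    rw [← he, hp]
  refine ⟨fun i => p i, hv0, hvind, fun i => (p i).2, fun i => by simp [hpe],
    fun i j hij => by simp [hpe, hij], fun f hf => ?_⟩
  have : (⟨f, hf⟩ : homogeneousSubmodule (Fin 3) k n) = ∑ j, eval (v j) f • p j := by
    refine hinj (funext fun i => ?_)
    simp [he, hpe, Pi.single_apply]
  simpa [smul_eq_C_mul] using congrArg Subtype.val this

theorem points_generic_symbolic_square_agrees_in_high_degree (k : Type*) [Field k]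
    (s : ℕ) (hs : 1 ≤ s)
    (v : Fin s → (Fin 3 → k)) (hv0 : ∀ i, v i ≠ 0)
    (hvind : ∀ i j, i ≠ j → LinearIndependent k ![v i, v j])
    (α : ℕ) (hα : α = sInf {t : ℕ | gradedPiece (pointsIdeal v) t ≠ ⊥})
    (hcard : s = Nat.choose (α + 1) 2)
    (hgen : ∀ i : ℕ, Nat.choose (i + 2) 2 - Module.finrank k (gradedPiece (pointsIdeal v) i) =
      min (Nat.choose (i + 2) 2) s) :
    ∀ t : ℕ, 2 * α ≤ t →
      gradedPiece (pointsSymb v 2) t = gradedPiece (pointsIdeal v ^ 2) t := by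
  obtain _ | n := α
  · simp only [zero_add] at hcard
    rw [Nat.choose_eq_zero_of_lt one_lt_two] at hcard
    omega
  have hbot : gradedPiece (pointsIdeal v) n = ⊥ := by
    by_contra hne
    exact Nat.notMem_of_lt_sInf (n.lt_succ_self.trans_eq hα) hne
  obtain ⟨p, hp⟩ := exists_isSeparatorBasis hv0 hvind hcard hbot
  intro t ht
  obtain ⟨m, rfl⟩ : ∃ m, t = n + (n + (m + 2)) := ⟨t - 2 * (n + 1), by omega⟩
  ext F
  exact ⟨fun hF => ⟨hp.mem_pointsIdeal_sq_of_mem_pointsSymb hF.2 hF.1, hF.2⟩,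
    fun hF => ⟨pointsIdeal_sq_le_pointsSymb v hF.1, hF.2⟩⟩
end

section
/- Let v_1, v_2, v_3 ∈ k³ be linearly independent (three non-collinear points X in ℙ²), and for each pair 1 ≤ i < j ≤ 3 let L_{ij} ∈ R be a nonzero linear form vanishing at both v_i and v_j. Then I_X^{(2)} = I_X^2 + ⟨L_{12}·L_{13}·L_{23}⟩ and I_X^{(2)} ≠ I_X^2; in particular sdefect(I_X, 2) = 1. -/
open MvPolynomial

set_option synthInstance.maxHeartbeats 1000000
set_option maxHeartbeats 1000000

section LinearForms

variable {k σ : Type*} [Field k]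

theorem MvPolynomial.IsHomogeneous.exists_eq_sum_C_mul_X [Fintype σ]
    {F : MvPolynomial σ k} (hF : F.IsHomogeneous 1) :
    ∃ c : σ → k, F = ∑ i, C (c i) * X i := by
  have h : F ∈ Submodule.span k (Set.range (X : σ → MvPolynomial σ k)) := by
    rw [← homogeneousSubmodule_one_eq_span_X]
    exact hF
  obtain ⟨c, hc⟩ := (Submodule.mem_span_range_iff_exists_fun k).1 h
  exact ⟨c, by simp [← hc, MvPolynomial.smul_eq_C_mul]⟩

/-- A linear form vanishing on a basis is zero. -/
theorem MvPolynomial.IsHomogeneous.eq_zero_of_eval_eq_zero [Fintype σ] [Nonempty σ]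
    {v : σ → σ → k} (hv : LinearIndependent k v)
    {F : MvPolynomial σ k} (hF : F.IsHomogeneous 1) (h : ∀ i, eval (v i) F = 0) : F = 0 := by
  classical
  obtain ⟨c, rfl⟩ := hF.exists_eq_sum_C_mul_X
  have hmap : Fintype.linearCombination k c = 0 := by
    refine (basisOfLinearIndependentOfCardEqFinrank hv (by simp)).ext fun i => ?_
    have := h i
    simp only [map_sum, map_mul, eval_C, eval_X] at this
    simpa [Fintype.linearCombination_apply, mul_comm] using this
  have hc : ∀ i, c i = 0 := fun i => by
    simpa using LinearMap.congr_fun hmap (Pi.single i 1)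
  simp [hc]

/-- A linear form is determined by its values on a basis `v`, through the forms `L i` vanishing
on all members of the basis but `v i`. -/
theorem MvPolynomial.IsHomogeneous.eq_sum_of_dual [Fintype σ] [Nonempty σ]
    {v : σ → σ → k} (hv : LinearIndependent k v) {L : σ → MvPolynomial σ k}
    (hL : ∀ i, (L i).IsHomogeneous 1) (h0 : ∀ i, L i ≠ 0)
    (hLv : ∀ i j, i ≠ j → eval (v j) (L i) = 0)
    {F : MvPolynomial σ k} (hF : F.IsHomogeneous 1) :
    F = ∑ i, C (eval (v i) F / eval (v i) (L i)) * L i := by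
  have hd : ∀ i, eval (v i) (L i) ≠ 0 := fun i hi => h0 i <|
    (hL i).eq_zero_of_eval_eq_zero hv fun j => by
      by_cases hij : i = j
      · exact hij ▸ hi
      · exact hLv i j hij
  rw [← sub_eq_zero]
  refine IsHomogeneous.eq_zero_of_eval_eq_zero hv (hF.sub ?_) fun j => ?_
  · exact IsHomogeneous.sum _ _ _ fun i _ => (hL i).C_mul _
  · rw [map_sub, map_sum, Finset.sum_eq_single j]
    · simp [hd j]
    · intro i _ hij
      simp [hLv i j hij]
    · simp

/-- Linear forms dual to a basis form a system of coordinates. -/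
theorem exists_algEquiv_X_eq_of_dual [Fintype σ] [Nonempty σ]
    {v : σ → σ → k} (hv : LinearIndependent k v) {L : σ → MvPolynomial σ k}
    (hL : ∀ i, (L i).IsHomogeneous 1) (h0 : ∀ i, L i ≠ 0)
    (hLv : ∀ i j, i ≠ j → eval (v j) (L i) = 0) :
    ∃ e : MvPolynomial σ k ≃ₐ[k] MvPolynomial σ k, ∀ i, e (X i) = L i := by
  classical
  have hd : ∀ i, eval (v i) (L i) ≠ 0 := fun i hi => h0 i <|
    (hL i).eq_zero_of_eval_eq_zero hv fun j => by
      by_cases hij : i = j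
      · exact hij ▸ hi
      · exact hLv i j hij
  let ψ : MvPolynomial σ k →ₐ[k] MvPolynomial σ k :=
    aeval fun j => ∑ i, C (v i j / eval (v i) (L i)) * X i
  have hψ : ∀ F : MvPolynomial σ k, F.IsHomogeneous 1 →
      ψ F = ∑ i, C (eval (v i) F / eval (v i) (L i)) * X i := by
    intro F hF
    obtain ⟨c, rfl⟩ := hF.exists_eq_sum_C_mul_X
    simp only [ψ, map_sum, map_mul, aeval_X, eval_X, eval_C, algHom_C, algebraMap_eq,
      Finset.mul_sum, Finset.sum_div, Finset.sum_mul]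
    rw [Finset.sum_comm]
    simp only [← mul_assoc, ← C_mul, mul_div_assoc]
  refine ⟨AlgEquiv.ofAlgHom (aeval L) ψ ?_ ?_, fun i => by simp⟩
  · ext1 j
    simp only [ψ, AlgHom.comp_apply, aeval_X, map_sum, map_mul, algHom_C, algebraMap_eq,
      AlgHom.id_apply]
    simpa using ((isHomogeneous_X k j).eq_sum_of_dual hv hL h0 hLv).symm
  · ext1 j
    simp only [AlgHom.comp_apply, aeval_X, AlgHom.id_apply]
    rw [hψ _ (hL j), Finset.sum_eq_single j]
    · simp [hd j]
    · intro i _ hij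
      simp [hLv j i hij.symm]
    · simp

theorem pointIdeal_eq_map_of_dual {v : Fin 3 → Fin 3 → k} (hv : LinearIndependent k v)
    {L : Fin 3 → MvPolynomial (Fin 3) k}
    (hL : ∀ i, (L i).IsHomogeneous 1) (h0 : ∀ i, L i ≠ 0)
    (hLv : ∀ i j, i ≠ j → eval (v j) (L i) = 0)
    (e : MvPolynomial (Fin 3) k ≃ₐ[k] MvPolynomial (Fin 3) k) (he : ∀ i, e (X i) = L i)
    (i : Fin 3) :
    pointIdeal (v i) = (Ideal.span (X '' {i}ᶜ)).map
      (e : MvPolynomial (Fin 3) k ≃+* MvPolynomial (Fin 3) k) := by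
  rw [Ideal.map_span, Set.image_image]
  apply le_antisymm
  · refine Ideal.span_le.2 ?_
    rintro F ⟨hF, hFv⟩
    rw [hF.eq_sum_of_dual hv hL h0 hLv]
    refine Ideal.sum_mem _ fun j _ => ?_
    by_cases hj : j = i
    · subst hj
      simp [hFv]
    · exact Ideal.mul_mem_left _ _ (Ideal.subset_span ⟨j, hj, he j⟩)
  · refine Ideal.span_mono ?_
    rintro _ ⟨j, hj, rfl⟩
    have : (e : MvPolynomial (Fin 3) k ≃+* MvPolynomial (Fin 3) k) (X j) = L j := he j
    simp only [this]
    exact ⟨hL j, hLv j i hj⟩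

end LinearForms

section MonomialIdeals

variable {k σ : Type*} [Field k]

/-- The ideal of polynomials all of whose monomials have weight at least `n`. -/
def weightIdeal (k : Type*) [Field k] {σ : Type*} (w : (σ →₀ ℕ) →+ ℕ) (n : ℕ) :
    Ideal (MvPolynomial σ k) where
  carrier := {f | ∀ m, coeff m f ≠ 0 → n ≤ w m}
  zero_mem' := by simp
  add_mem' := by
    intro f g hf hg m hm
    by_cases h : coeff m f = 0
    · exact hg m (by simpa [h] using hm)
    · exact hf m h
  smul_mem' := by
    classical
    intro f g hg m hm
    rw [smul_eq_mul, ← mem_support_iff] at hm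
    obtain ⟨a, -, b, hb, rfl⟩ := Finset.mem_add.1 (support_mul _ _ hm)
    rw [map_add]
    exact le_add_left (hg b (mem_support_iff.1 hb))

theorem mem_weightIdeal {w : (σ →₀ ℕ) →+ ℕ} {n : ℕ} {f : MvPolynomial σ k} :
    f ∈ weightIdeal k w n ↔ ∀ m, coeff m f ≠ 0 → n ≤ w m := Iff.rfl

theorem weightIdeal_mul_le (w : (σ →₀ ℕ) →+ ℕ) (a b : ℕ) :
    weightIdeal k w a * weightIdeal k w b ≤ weightIdeal k w (a + b) := by
  classical
  refine Ideal.mul_le.2 fun f hf g hg m hm => ?_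
  obtain ⟨p, hp, q, hq, rfl⟩ := Finset.mem_add.1 (support_mul _ _ (mem_support_iff.2 hm))
  rw [map_add]
  exact add_le_add (hf p (mem_support_iff.1 hp)) (hg q (mem_support_iff.1 hq))

theorem sq_le_weightIdeal {I : Ideal (MvPolynomial σ k)} {w : (σ →₀ ℕ) →+ ℕ} {n : ℕ}
    (h : I ≤ weightIdeal k w n) : I ^ 2 ≤ weightIdeal k w (n + n) := by
  rw [sq]
  exact (Ideal.mul_mono h h).trans (weightIdeal_mul_le w n n)

/-- The total degree of a monomial in the variables other than `i`. -/
def degreeOff (i : Fin 3) : (Fin 3 →₀ ℕ) →+ ℕ where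
  toFun m := m (i + 1) + m (i + 2)
  map_zero' := by simp
  map_add' a b := by simp only [Finsupp.add_apply]; ring

theorem span_X_compl_le_weightIdeal (i : Fin 3) :
    Ideal.span (X '' {i}ᶜ) ≤ weightIdeal k (degreeOff i) 1 := by
  classical
  refine Ideal.span_le.2 ?_
  rintro _ ⟨j, hj, rfl⟩ m hm
  rw [coeff_X] at hm
  obtain rfl : Finsupp.single j 1 = m := by
    by_contra h
    simp [h] at hm
  have : j = i + 1 ∨ j = i + 2 := by
    have h : ∀ i j : Fin 3, j ≠ i → j = i + 1 ∨ j = i + 2 := by decide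
    exact h i j hj
  rcases this with rfl | rfl <;> simp [degreeOff]

/-- The total degree of a monomial in three variables. -/
def degreeThree : (Fin 3 →₀ ℕ) →+ ℕ where
  toFun m := m 0 + m 1 + m 2
  map_zero' := by simp
  map_add' a b := by simp only [Finsupp.add_apply]; ring

variable (k) in
theorem inf_span_X_compl_le_weightIdeal :
    Ideal.span (X '' {0}ᶜ) ⊓ Ideal.span (X '' {1}ᶜ) ⊓ Ideal.span (X '' {2}ᶜ) ≤
      weightIdeal k degreeThree 2 := by
  rintro f ⟨⟨h0, h1⟩, h2⟩ m hm
  have h0 := span_X_compl_le_weightIdeal 0 h0 m hm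
  have h1 := span_X_compl_le_weightIdeal 1 h1 m hm
  have h2 := span_X_compl_le_weightIdeal 2 h2 m hm
  simp [degreeOff, degreeThree] at *
  omega

theorem X_mul_X_mem_inf_span_X_compl {i j : Fin 3} (hij : i ≠ j) :
    (X i * X j : MvPolynomial (Fin 3) k) ∈
      Ideal.span (X '' {0}ᶜ) ⊓ Ideal.span (X '' {1}ᶜ) ⊓ Ideal.span (X '' {2}ᶜ) := by
  have h : ∀ l, (X i * X j : MvPolynomial (Fin 3) k) ∈ Ideal.span (X '' {l}ᶜ) := fun l => by
    by_cases hi : i = l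
    · exact Ideal.mul_mem_left _ _ (Ideal.subset_span ⟨j, fun hj => hij (hi.trans hj.symm), rfl⟩)
    · exact Ideal.mul_mem_right _ _ (Ideal.subset_span ⟨i, hi, rfl⟩)
  exact ⟨⟨h 0, h 1⟩, h 2⟩

theorem X_mul_X_mul_X_mem_inf_sq :
    (X 2 * X 1 * X 0 : MvPolynomial (Fin 3) k) ∈
      Ideal.span (X '' {0}ᶜ) ^ 2 ⊓ Ideal.span (X '' {1}ᶜ) ^ 2 ⊓ Ideal.span (X '' {2}ᶜ) ^ 2 := by
  have h : ∀ i j l : Fin 3, i ≠ l → j ≠ l →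
      (X i * X j : MvPolynomial (Fin 3) k) ∈ Ideal.span (X '' {l}ᶜ) ^ 2 := by
    intro i j l hi hj
    rw [sq]
    exact Ideal.mul_mem_mul (Ideal.subset_span ⟨i, hi, rfl⟩) (Ideal.subset_span ⟨j, hj, rfl⟩)
  refine ⟨⟨Ideal.mul_mem_right _ _ (h 2 1 0 (by decide) (by decide)), ?_⟩, ?_⟩
  · rw [mul_right_comm]
    exact Ideal.mul_mem_right _ _ (h 2 0 1 (by decide) (by decide))
  · rw [mul_assoc]
    exact Ideal.mul_mem_left _ _ (h 1 0 2 (by decide) (by decide))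

theorem monomial_mem_of_le {I : Ideal (MvPolynomial σ k)} {a m : σ →₀ ℕ} (c : k)
    (ha : monomial a 1 ∈ I) (ham : a ≤ m) : monomial m c ∈ I :=
  I.mem_of_dvd (monomial_dvd_monomial.2 ⟨Or.inr ham, one_dvd c⟩) ha

variable (k) in
theorem inf_sq_span_X_compl :
    Ideal.span (X '' {0}ᶜ) ^ 2 ⊓ Ideal.span (X '' {1}ᶜ) ^ 2 ⊓ Ideal.span (X '' {2}ᶜ) ^ 2 =
      (Ideal.span (X '' {0}ᶜ) ⊓ Ideal.span (X '' {1}ᶜ) ⊓ Ideal.span (X '' {2}ᶜ)) ^ 2 +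
        Ideal.span {(X 2 * X 1 * X 0 : MvPolynomial (Fin 3) k)} := by
  apply le_antisymm
  · rintro f ⟨⟨h0, h1⟩, h2⟩
    rw [f.as_sum]
    refine Ideal.sum_mem _ fun m hm => ?_
    rw [mem_support_iff] at hm
    have h0 := sq_le_weightIdeal (span_X_compl_le_weightIdeal 0) h0 m hm
    have h1 := sq_le_weightIdeal (span_X_compl_le_weightIdeal 1) h1 m hm
    have h2 := sq_le_weightIdeal (span_X_compl_le_weightIdeal 2) h2 m hm
    have hsq : ∀ i j : Fin 3, i ≠ j → 2 ≤ m i → 2 ≤ m j →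
        monomial m (coeff m f) ∈
          (Ideal.span (X '' {0}ᶜ) ⊓ Ideal.span (X '' {1}ᶜ) ⊓ Ideal.span (X '' {2}ᶜ)) ^ 2 := by
      intro i j hij hi hj
      refine monomial_mem_of_le (a := Finsupp.single i 2 + Finsupp.single j 2) _ ?_ ?_
      · have := Ideal.pow_mem_pow (X_mul_X_mem_inf_span_X_compl (k := k) hij) 2
        rwa [mul_pow, X_pow_eq_monomial, X_pow_eq_monomial, monomial_mul, one_mul] at this
      · intro l
        by_cases hil : i = l
        · subst hil
          simpa [hij.symm] using hi
        · by_cases hjl : j = l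
          · subst hjl
            simpa [hij] using hj
          · simp [hil, hjl]
    simp [degreeOff] at h0 h1 h2
    by_cases hpos : 1 ≤ m 0 ∧ 1 ≤ m 1 ∧ 1 ≤ m 2
    · refine Ideal.mem_sup_right (monomial_mem_of_le
        (a := Finsupp.single 2 1 + Finsupp.single 1 1 + Finsupp.single 0 1) _ ?_ ?_)
      · simp [X, monomial_mul]
      · intro l
        fin_cases l <;> simp [hpos]
    · refine Ideal.mem_sup_left ?_
      by_cases hm0 : m 0 = 0
      · exact hsq 1 2 (by decide) (by omega) (by omega)
      · by_cases hm1 : m 1 = 0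
        · exact hsq 0 2 (by decide) (by omega) (by omega)
        · exact hsq 0 1 (by decide) (by omega) (by omega)
  · refine sup_le (le_inf (le_inf ?_ ?_) ?_) ?_
    · exact Ideal.pow_right_mono (inf_le_left.trans inf_le_left) 2
    · exact Ideal.pow_right_mono (inf_le_left.trans inf_le_right) 2
    · exact Ideal.pow_right_mono inf_le_right 2
    · exact (Ideal.span_singleton_le_iff_mem _).2 X_mul_X_mul_X_mem_inf_sq

variable (k) in
theorem inf_sq_span_X_compl_ne :
    (Ideal.span (X '' {0}ᶜ) ^ 2 ⊓ Ideal.span (X '' {1}ᶜ) ^ 2 ⊓ Ideal.span (X '' {2}ᶜ) ^ 2 :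
      Ideal (MvPolynomial (Fin 3) k)) ≠
      (Ideal.span (X '' {0}ᶜ) ⊓ Ideal.span (X '' {1}ᶜ) ⊓ Ideal.span (X '' {2}ᶜ)) ^ 2 := by
  intro h
  have hmem := X_mul_X_mul_X_mem_inf_sq (k := k)
  rw [h] at hmem
  have := sq_le_weightIdeal (inf_span_X_compl_le_weightIdeal k) hmem
    (Finsupp.single 2 1 + Finsupp.single 1 1 + Finsupp.single 0 1) (by simp [X, monomial_mul])
  simp [degreeThree] at this

end MonomialIdeals

theorem Ideal.map_inf_ringEquiv {R S : Type*} [CommRing R] [CommRing S] (e : R ≃+* S)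
    (I J : Ideal R) : (I ⊓ J).map e = I.map e ⊓ J.map e := by
  simp only [← Ideal.comap_symm, Ideal.comap_inf]

theorem three_noncollinear_points_sdefect_one (k : Type*) [Field k]
    (v₁ v₂ v₃ : Fin 3 → k) (hind : LinearIndependent k ![v₁, v₂, v₃])
    (L₁₂ L₁₃ L₂₃ : MvPolynomial (Fin 3) k)
    (h₁₂ : L₁₂.IsHomogeneous 1) (h₁₂0 : L₁₂ ≠ 0)
    (h₁₂v : MvPolynomial.eval v₁ L₁₂ = 0 ∧ MvPolynomial.eval v₂ L₁₂ = 0)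
    (h₁₃ : L₁₃.IsHomogeneous 1) (h₁₃0 : L₁₃ ≠ 0)
    (h₁₃v : MvPolynomial.eval v₁ L₁₃ = 0 ∧ MvPolynomial.eval v₃ L₁₃ = 0)
    (h₂₃ : L₂₃.IsHomogeneous 1) (h₂₃0 : L₂₃ ≠ 0)
    (h₂₃v : MvPolynomial.eval v₂ L₂₃ = 0 ∧ MvPolynomial.eval v₃ L₂₃ = 0) :
    pointIdeal v₁ ^ 2 ⊓ pointIdeal v₂ ^ 2 ⊓ pointIdeal v₃ ^ 2 =
      (pointIdeal v₁ ⊓ pointIdeal v₂ ⊓ pointIdeal v₃) ^ 2 +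
        Ideal.span {L₁₂ * L₁₃ * L₂₃} ∧
    pointIdeal v₁ ^ 2 ⊓ pointIdeal v₂ ^ 2 ⊓ pointIdeal v₃ ^ 2 ≠
      (pointIdeal v₁ ⊓ pointIdeal v₂ ⊓ pointIdeal v₃) ^ 2 := by
  have hL : ∀ i, ((![L₂₃, L₁₃, L₁₂] : Fin 3 → _) i).IsHomogeneous 1 := by
    simp [Fin.forall_fin_succ, *]
  have h0 : ∀ i, (![L₂₃, L₁₃, L₁₂] : Fin 3 → _) i ≠ 0 := by
    simp [Fin.forall_fin_succ, *]
  have hLv : ∀ i j, i ≠ j →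
      eval ((![v₁, v₂, v₃] : Fin 3 → _) j) ((![L₂₃, L₁₃, L₁₂] : Fin 3 → _) i) = 0 := by
    simp [Fin.forall_fin_succ, *]
  obtain ⟨e, he⟩ := exists_algEquiv_X_eq_of_dual hind hL h0 hLv
  have hp := pointIdeal_eq_map_of_dual hind hL h0 hLv e he
  have hp₁ : pointIdeal v₁ = _ := hp 0
  have hp₂ : pointIdeal v₂ = _ := hp 1
  have hp₃ : pointIdeal v₃ = _ := hp 2
  have hF : Ideal.span {L₁₂ * L₁₃ * L₂₃} =
      (Ideal.span {(X 2 * X 1 * X 0 : MvPolynomial (Fin 3) k)}).map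
        (e : MvPolynomial (Fin 3) k ≃+* MvPolynomial (Fin 3) k) := by
    rw [Ideal.map_span, Set.image_singleton]
    simp [he]
  rw [hp₁, hp₂, hp₃, hF]
  simp only [← Ideal.map_pow, ← Ideal.map_inf_ringEquiv, Submodule.add_eq_sup, ← Ideal.map_sup]
  constructor
  · rw [inf_sq_span_X_compl, Submodule.add_eq_sup]
  · intro h
    refine inf_sq_span_X_compl_ne k ?_
    have := congrArg (Ideal.comap (e : MvPolynomial (Fin 3) k ≃+* MvPolynomial (Fin 3) k)) h
    simpa only [Ideal.comap_map_of_bijective _ (RingEquiv.bijective _)] using this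
end
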